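/- There is an absolute constant C such that for every weight ω on ℝ with [ω]_{A₂} < ∞ and every J ∈ 𝒟: ∑_{I∈𝒟, I⊆J} |⟨ω^{-1}, h_I⟩ ⟨ω, h_{I₋}⟩| / ⟨ω^{-1}⟩_I ≤ C [ω]_{A₂} ω(J). -/

import Mathlib

open MeasureTheory ENNReal NNReal

noncomputable section

/-- The dyadic interval `[2^n k, 2^n (k+1))`, encoded by the pair `p = (n, k)`. -/
def dyad (p : ℤ × ℤ) : Set ℝ := Set.Ico ((2:ℝ) ^ p.1 * p.2) ((2:ℝ) ^ p.1 * (p.2 + 1))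

/-- The length `2^n` of the dyadic interval encoded by `p = (n, k)`. -/
def len (p : ℤ × ℤ) : ℝ := (2:ℝ) ^ p.1

/-- The left half `I₋` of the dyadic interval. -/
def lhalf (p : ℤ × ℤ) : ℤ × ℤ := (p.1 - 1, 2 * p.2)

/-- The right half `I₊` of the dyadic interval. -/
def rhalf (p : ℤ × ℤ) : ℤ × ℤ := (p.1 - 1, 2 * p.2 + 1)

/-- The average `⟨f⟩_I = |I|⁻¹ ∫_I f` over the dyadic interval `p`. -/
def avg (f : ℝ → ℝ) (p : ℤ × ℤ) : ℝ := (len p)⁻¹ * ∫ x in dyad p, f x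

/-- The Haar function `h_I = |I|^{-1/2} (1_{I₋} - 1_{I₊})`. -/
def haar (p : ℤ × ℤ) : ℝ → ℝ := fun x =>
  (Real.sqrt (len p))⁻¹ *
    ((dyad (lhalf p)).indicator (fun _ => (1:ℝ)) x -
      (dyad (rhalf p)).indicator (fun _ => (1:ℝ)) x)

/-- The Haar coefficient `⟨f, h_I⟩ = ∫ f h_I`. -/
def haarCoeff (f : ℝ → ℝ) (p : ℤ × ℤ) : ℝ := ∫ x, f x * haar p x

/-- The A₂ characteristic `[ω]_{A₂} = sup_I ⟨ω⟩_I ⟨ω⁻¹⟩_I`, valued in `ℝ≥0∞`. -/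
def A2 (ω : ℝ → ℝ) : ℝ≥0∞ :=
  ⨆ p : ℤ × ℤ, ENNReal.ofReal (avg ω p * avg (fun x => (ω x)⁻¹) p)

/-- `ω` is a weight: measurable, positive, with `ω` and `ω⁻¹` locally integrable. -/
def IsWeight (ω : ℝ → ℝ) : Prop :=
  Measurable ω ∧ (∀ x, 0 < ω x) ∧
    LocallyIntegrable ω volume ∧ LocallyIntegrable (fun x => (ω x)⁻¹) volume

/-- The measure `ω dx`. -/
def wMeasure (ω : ℝ → ℝ) : Measure ℝ := volume.withDensity fun x => ENNReal.ofReal (ω x)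

/-- `ω^{1/2}`. -/
def sqrtw (ω : ℝ → ℝ) : ℝ → ℝ := fun x => Real.sqrt (ω x)

/-- `ω^{-1/2}`. -/
def invSqrtw (ω : ℝ → ℝ) : ℝ → ℝ := fun x => (Real.sqrt (ω x))⁻¹

/-! ### Dyadic intervals -/

lemma len_pos (p : ℤ × ℤ) : 0 < len p := by unfold len; positivity

lemma len_lhalf (p : ℤ × ℤ) : len (lhalf p) = len p / 2 := by
  simp only [len, lhalf]
  rw [zpow_sub_one₀ (by norm_num)]; ring

lemma len_rhalf (p : ℤ × ℤ) : len (rhalf p) = len p / 2 := by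
  simp only [len, rhalf]
  rw [zpow_sub_one₀ (by norm_num)]; ring

lemma dyad_lhalf (p : ℤ × ℤ) :
    dyad (lhalf p) = Set.Ico (len p * p.2) (len p * p.2 + len p / 2) := by
  have h : (2 : ℝ) ^ (p.1 - 1) = len p / 2 := len_lhalf p
  simp only [dyad, lhalf, h]
  push_cast
  congr 1 <;> ring

lemma dyad_rhalf (p : ℤ × ℤ) :
    dyad (rhalf p) = Set.Ico (len p * p.2 + len p / 2) (len p * (p.2 + 1)) := by
  have h : (2 : ℝ) ^ (p.1 - 1) = len p / 2 := len_rhalf p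
  simp only [dyad, rhalf, h]
  push_cast
  congr 1 <;> ring

lemma dyad_eq_union (p : ℤ × ℤ) : dyad p = dyad (lhalf p) ∪ dyad (rhalf p) := by
  have h := len_pos p
  rw [dyad_lhalf, dyad_rhalf, Set.Ico_union_Ico_eq_Ico (by linarith) (by linarith)]
  rfl

lemma disjoint_dyad_halves (p : ℤ × ℤ) : Disjoint (dyad (lhalf p)) (dyad (rhalf p)) := by
  rw [dyad_lhalf, dyad_rhalf]
  exact Set.Ico_disjoint_Ico_same

lemma measurableSet_dyad (p : ℤ × ℤ) : MeasurableSet (dyad p) := measurableSet_Ico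

lemma volume_dyad (p : ℤ × ℤ) : volume (dyad p) = ENNReal.ofReal (len p) := by
  rw [dyad, Real.volume_Ico, len]
  congr 1; ring

lemma integrableOn_dyad {f : ℝ → ℝ} (hf : LocallyIntegrable f volume) (p : ℤ × ℤ) :
    IntegrableOn f (dyad p) volume :=
  (hf.integrableOn_isCompact isCompact_Icc).mono_set Set.Ico_subset_Icc_self

/-! ### Averages and Haar coefficients -/

lemma integral_dyad_split {f : ℝ → ℝ} (hf : LocallyIntegrable f volume) (p : ℤ × ℤ) :
    ∫ x in dyad p, f x = (∫ x in dyad (lhalf p), f x) + ∫ x in dyad (rhalf p), f x := by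
  rw [dyad_eq_union p]
  exact setIntegral_union (disjoint_dyad_halves p) (measurableSet_dyad _)
    (integrableOn_dyad hf _) (integrableOn_dyad hf _)

lemma integral_dyad_eq (f : ℝ → ℝ) (p : ℤ × ℤ) : ∫ x in dyad p, f x = len p * avg f p := by
  have h := (len_pos p).ne'
  rw [avg]; field_simp

lemma avg_eq_halves {f : ℝ → ℝ} (hf : LocallyIntegrable f volume) (p : ℤ × ℤ) :
    avg f p = (avg f (lhalf p) + avg f (rhalf p)) / 2 := by
  have h := (len_pos p).ne'
  have h1 := integral_dyad_split hf p
  simp only [integral_dyad_eq, len_lhalf, len_rhalf] at h1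
  apply mul_left_cancel₀ h
  rw [h1]; ring

lemma haarCoeff_sq {f : ℝ → ℝ} (hf : LocallyIntegrable f volume) (p : ℤ × ℤ) :
    haarCoeff f p ^ 2 = len p * ((avg f (lhalf p) - avg f (rhalf p)) / 2) ^ 2 := by
  have h := len_pos p
  have key : haarCoeff f p = (Real.sqrt (len p))⁻¹ *
      ((∫ x in dyad (lhalf p), f x) - ∫ x in dyad (rhalf p), f x) := by
    have h1 : ∀ x, f x * haar p x = (Real.sqrt (len p))⁻¹ *
        ((dyad (lhalf p)).indicator f x - (dyad (rhalf p)).indicator f x) := by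
      intro x
      by_cases hl : x ∈ dyad (lhalf p) <;> by_cases hr : x ∈ dyad (rhalf p) <;>
        simp [haar, hl, hr, mul_comm]
    simp only [haarCoeff, h1]
    rw [integral_const_mul, integral_sub
      ((integrable_indicator_iff (measurableSet_dyad _)).2 (integrableOn_dyad hf _))
      ((integrable_indicator_iff (measurableSet_dyad _)).2 (integrableOn_dyad hf _)),
      integral_indicator (measurableSet_dyad _), integral_indicator (measurableSet_dyad _)]
  rw [key, mul_pow, inv_pow, Real.sq_sqrt h.le, integral_dyad_eq, integral_dyad_eq,
    len_lhalf, len_rhalf]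
  field_simp

lemma avg_pos {f : ℝ → ℝ} (hf : LocallyIntegrable f volume) (hpos : ∀ x, 0 < f x)
    (p : ℤ × ℤ) : 0 < avg f p := by
  refine mul_pos (inv_pos.2 (len_pos p)) ?_
  rw [setIntegral_pos_iff_support_of_nonneg_ae (Filter.Eventually.of_forall fun x => (hpos x).le)
    (integrableOn_dyad hf p)]
  have : Function.support f = Set.univ := Set.eq_univ_of_forall fun x => (hpos x).ne'
  rw [this, Set.univ_inter, volume_dyad]
  exact ENNReal.ofReal_pos.2 (len_pos p)

lemma one_le_avg_mul_avg_inv {ω : ℝ → ℝ} (hω : IsWeight ω) (p : ℤ × ℤ) :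
    1 ≤ avg ω p * avg (fun x => (ω x)⁻¹) p := by
  obtain ⟨-, hpos, hi, hi'⟩ := hω
  have hl := len_pos p
  have hu := avg_pos hi hpos p
  set u := avg ω p with hu_def
  have hmono : ∫ _ in dyad p, (2 : ℝ) ≤ ∫ x in dyad p, (u⁻¹ * ω x + u * (ω x)⁻¹) := by
    refine setIntegral_mono_on (integrableOn_const (by rw [volume_dyad]; exact ofReal_ne_top))
      (((integrableOn_dyad hi p).const_mul _).add ((integrableOn_dyad hi' p).const_mul _))
      (measurableSet_dyad p) fun x _ => ?_
    have hx := hpos x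
    have : u⁻¹ * ω x + u * (ω x)⁻¹ - 2 = (ω x - u) ^ 2 / (u * ω x) := by field_simp; ring
    have : 0 ≤ (ω x - u) ^ 2 / (u * ω x) := by positivity
    linarith
  rw [integral_add ((integrableOn_dyad hi p).const_mul _) ((integrableOn_dyad hi' p).const_mul _),
    integral_const_mul, integral_const_mul, setIntegral_const, Measure.real, volume_dyad,
    toReal_ofReal hl.le, smul_eq_mul, integral_dyad_eq ω,
    integral_dyad_eq (fun x => (ω x)⁻¹), ← hu_def] at hmono
  have h2 : u⁻¹ * (len p * u) = len p := by field_simp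
  rw [h2] at hmono
  nlinarith

/-! ### Bellman function inequalities -/

lemma sub_one_add_sq_le_mul_log {x : ℝ} (hx : 0 < x) (hx2 : x < 2) :
    x - 1 + (x - 1) ^ 2 / 6 ≤ x * Real.log x := by
  obtain ⟨t, ht, rfl⟩ : ∃ t : ℝ, 0 < t ∧ x = t ^ 2 :=
    ⟨Real.sqrt x, Real.sqrt_pos.2 hx, (Real.sq_sqrt hx.le).symm⟩
  have h1 := Real.one_sub_inv_le_log_of_pos ht
  have h2 : t ^ 2 * (1 - t⁻¹) = t ^ 2 - t := by field_simp
  have h3 : t ^ 2 * (1 - t⁻¹) ≤ t ^ 2 * Real.log t := by gcongr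
  have ht2 : t ≤ 3 / 2 - 1 / 16 := by nlinarith
  have h4 : (t + 1) ^ 2 ≤ 6 := by nlinarith
  have h5 : (t ^ 2 - 1) ^ 2 ≤ 6 * (t - 1) ^ 2 := by
    have : (t ^ 2 - 1) ^ 2 = (t + 1) ^ 2 * (t - 1) ^ 2 := by ring
    rw [this]
    exact mul_le_mul_of_nonneg_right h4 (sq_nonneg _)
  rw [Real.log_pow]
  push_cast
  nlinarith

lemma log_sq_le {w : ℝ} (hw : 0 < w) : (Real.log w) ^ 2 ≤ 4 * ((w - 1) ^ 2 / w) := by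
  obtain ⟨t, ht, rfl⟩ : ∃ t : ℝ, 0 < t ∧ w = t ^ 2 :=
    ⟨Real.sqrt w, Real.sqrt_pos.2 hw, (Real.sq_sqrt hw.le).symm⟩
  have h1 := Real.one_sub_inv_le_log_of_pos ht
  have h2 := Real.log_le_sub_one_of_pos ht
  have h3 : (t ^ 2 - 1) ^ 2 / t ^ 2 = (t - t⁻¹) ^ 2 := by field_simp
  rw [h3, Real.log_pow]
  have hinv : t * t⁻¹ = 1 := mul_inv_cancel₀ ht.ne'
  have hi : 0 < t⁻¹ := inv_pos.2 ht
  have key : (Real.log t) ^ 2 ≤ (t - t⁻¹) ^ 2 := by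
    rw [sq_le_sq]
    rcases le_total 1 t with h | h
    · have : t⁻¹ ≤ 1 := inv_le_one_of_one_le₀ h
      rw [abs_of_nonneg (by linarith), abs_of_nonneg (by linarith)]
      linarith
    · have : 1 ≤ t⁻¹ := (one_le_inv₀ ht).2 h
      rw [abs_of_nonpos (by linarith), abs_of_nonpos (by linarith)]
      linarith
  push_cast
  nlinarith

/-- Quantitative convexity of `v ↦ 1 / v`. -/
lemma sq_div_cube_le_inv {c d : ℝ} (hc : 0 < c) (hd : 0 < d) :
    ((c - d) / 2) ^ 2 / ((c + d) / 2) ^ 3 ≤ (1 / c + 1 / d) / 2 - 1 / ((c + d) / 2) := by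
  have h : (1 / c + 1 / d) / 2 - 1 / ((c + d) / 2) =
      ((c - d) / 2) ^ 2 / (((c + d) / 2) * (c * d)) := by
    field_simp; ring
  rw [h]
  gcongr
  nlinarith [sq_nonneg (c - d), mul_nonneg (add_pos hc hd).le (sq_nonneg (c - d))]

/-- Quantitative midpoint convexity of `(u, v) ↦ u log (u v) + 13 Q / v` at points `u v ≤ Q`. -/
lemma sq_div_le_bellman {a b c d Q : ℝ} (ha : 0 < a) (hb : 0 < b) (hc : 0 < c) (hd : 0 < d)
    (hQ : (a + b) / 2 * ((c + d) / 2) ≤ Q) :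
    ((a - b) / 2) ^ 2 / (12 * ((a + b) / 2)) ≤
      ((a * Real.log (a * c) + 13 * Q / c) + (b * Real.log (b * d) + 13 * Q / d)) / 2 -
        ((a + b) / 2 * Real.log ((a + b) / 2 * ((c + d) / 2)) + 13 * Q / ((c + d) / 2)) := by
  obtain ⟨u, hu⟩ : ∃ u, u = (a + b) / 2 := ⟨_, rfl⟩
  obtain ⟨v, hv⟩ : ∃ v, v = (c + d) / 2 := ⟨_, rfl⟩
  obtain ⟨α, hα⟩ : ∃ α, α = (a - b) / 2 := ⟨_, rfl⟩
  rw [← hu, ← hv, ← hα]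
  rw [← hu, ← hv] at hQ
  have hu0 : 0 < u := by rw [hu]; positivity
  have hv0 : 0 < v := by rw [hv]; positivity
  obtain ⟨X, hX⟩ : ∃ X, X = ((c - d) / 2) ^ 2 / (c * d) := ⟨_, rfl⟩
  have hX0 : 0 ≤ X := by rw [hX]; positivity
  have hA : α ^ 2 / (6 * u) ≤ (a * Real.log (a / u) + b * Real.log (b / u)) / 2 := by
    have h1 := sub_one_add_sq_le_mul_log (div_pos ha hu0) (by rw [div_lt_iff₀ hu0]; linarith)
    have h2 := sub_one_add_sq_le_mul_log (div_pos hb hu0) (by rw [div_lt_iff₀ hu0]; linarith)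
    have h3 := mul_le_mul_of_nonneg_left (add_le_add h1 h2) hu0.le
    have ea : a = u + α := by rw [hu, hα]; ring
    have eb : b = u - α := by rw [hu, hα]; ring
    have e1 : u * (a / u - 1 + (a / u - 1) ^ 2 / 6 + (b / u - 1 + (b / u - 1) ^ 2 / 6)) =
        2 * (α ^ 2 / (6 * u)) := by
      rw [ea, eb]; field_simp; ring
    have e2 : u * (a / u * Real.log (a / u) + b / u * Real.log (b / u)) =
        a * Real.log (a / u) + b * Real.log (b / u) := by
      field_simp
    rw [e1, e2] at h3
    linarith
  have hB : -(u * X / 2) - α ^ 2 / (12 * u) - 12 * u * X ≤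
      (a * Real.log (c / v) + b * Real.log (d / v)) / 2 := by
    have e : (a * Real.log (c / v) + b * Real.log (d / v)) / 2 =
        u * Real.log (c / v * (d / v)) / 2 + α * (Real.log (c / d) / 2) := by
      rw [Real.log_mul (by positivity) (by positivity), Real.log_div hc.ne' hv0.ne',
        Real.log_div hd.ne' hv0.ne', Real.log_div hc.ne' hd.ne', hu, hα]
      ring
    have h1 : -X ≤ Real.log (c / v * (d / v)) := by
      have := Real.one_sub_inv_le_log_of_pos (x := c / v * (d / v)) (by positivity)
      have e1 : 1 - (c / v * (d / v))⁻¹ = -X := by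
        rw [hX, hv]; field_simp; ring
      linarith
    obtain ⟨L, hL⟩ : ∃ L, L = Real.log (c / d) / 2 := ⟨_, rfl⟩
    have h2 : L ^ 2 ≤ 4 * X := by
      have := log_sq_le (div_pos hc hd)
      have e1 : (c / d - 1) ^ 2 / (c / d) = 4 * X := by rw [hX]; field_simp; ring
      rw [hL, div_pow]; linarith
    have h3 : -(α ^ 2 / (12 * u)) - 3 * u * L ^ 2 ≤ α * L := by
      have e1 : α ^ 2 / (12 * u) + 3 * u * L ^ 2 + α * L = (α + 6 * u * L) ^ 2 / (12 * u) := by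
        field_simp; ring
      have : 0 ≤ (α + 6 * u * L) ^ 2 / (12 * u) := by positivity
      linarith
    rw [e, ← hL]
    have h4 := mul_le_mul_of_nonneg_left h1 hu0.le
    have h5 := mul_le_mul_of_nonneg_left h2 hu0.le
    linarith
  have hC : 13 * (u * X) ≤ (13 * Q / c + 13 * Q / d) / 2 - 13 * Q / v := by
    have e1 : (13 * Q / c + 13 * Q / d) / 2 - 13 * Q / v = 13 * (Q / v * X) := by
      rw [hX, hv]; field_simp; ring
    have h1 : u ≤ Q / v := by rwa [le_div_iff₀ hv0]
    have := mul_le_mul_of_nonneg_right h1 hX0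
    linarith
  have eD : a * Real.log (a * c) + b * Real.log (b * d) =
      2 * (u * Real.log (u * v)) + (a * Real.log (a / u) + b * Real.log (b / u)) +
        (a * Real.log (c / v) + b * Real.log (d / v)) := by
    rw [Real.log_mul ha.ne' hc.ne', Real.log_mul hb.ne' hd.ne', Real.log_mul hu0.ne' hv0.ne',
      Real.log_div hc.ne' hv0.ne', Real.log_div hd.ne' hv0.ne', Real.log_div ha.ne' hu0.ne',
      Real.log_div hb.ne' hu0.ne']
    have : 2 * u = a + b := by rw [hu]; ring
    linear_combination -(Real.log u + Real.log v) * this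
  have e6 : α ^ 2 / (6 * u) = 2 * (α ^ 2 / (12 * u)) := by field_simp; ring
  have := mul_nonneg hu0.le hX0
  linarith

/-! ### Summation over the dyadic tree -/

/-- The dyadic descendants of `q` of generation less than `n`. -/
def descendants : ℕ → ℤ × ℤ → Finset (ℤ × ℤ)
  | 0, _ => ∅
  | n + 1, q => {q} ∪ (descendants n (lhalf q) ∪ descendants n (rhalf q))

lemma mem_descendants (d : ℕ) : ∀ (e m k : ℤ), 2 ^ d * m ≤ k → k + 1 ≤ 2 ^ d * (m + 1) →
    ∀ n, d < n → (e - d, k) ∈ descendants n (e, m) := by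
  induction d with
  | zero =>
    intro e m k h1 h2 n hn
    obtain ⟨n, rfl⟩ : ∃ n', n = n' + 1 := ⟨n - 1, by omega⟩
    obtain rfl : k = m := by simp at h1 h2; omega
    simp [descendants]
  | succ d ih =>
    intro e m k h1 h2 n hn
    obtain ⟨n, rfl⟩ : ∃ n', n = n' + 1 := ⟨n - 1, by omega⟩
    have he : e - ((d + 1 : ℕ) : ℤ) = e - 1 - d := by push_cast; ring
    rw [descendants, he, Finset.mem_union, Finset.mem_union]
    right
    rw [pow_succ] at h1 h2
    rcases lt_or_ge k (2 ^ d * (2 * m + 1)) with h | h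
    · left
      exact ih (e - 1) (2 * m) k (by linarith) (by linarith) n (by omega)
    · right
      exact ih (e - 1) (2 * m + 1) k h (by linarith) n (by omega)

lemma exists_mem_descendants {p q : ℤ × ℤ} (h : dyad p ⊆ dyad q) :
    ∃ N, ∀ n, N < n → p ∈ descendants n q := by
  have hp := len_pos p
  have hq := len_pos q
  have hlt : (2 : ℝ) ^ p.1 * p.2 < (2 : ℝ) ^ p.1 * (p.2 + 1) := by
    have : (0 : ℝ) < 2 ^ p.1 := hp
    nlinarith
  obtain ⟨h1, h2⟩ := (Set.Ico_subset_Ico_iff hlt).1 h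
  have hle : p.1 ≤ q.1 := by
    have : (2 : ℝ) ^ p.1 ≤ 2 ^ q.1 := by linarith
    exact (zpow_le_zpow_iff_right₀ (by norm_num)).1 this
  obtain ⟨d, hd⟩ := Int.eq_ofNat_of_zero_le (sub_nonneg.2 hle)
  have hpow : (2 : ℝ) ^ q.1 = 2 ^ p.1 * 2 ^ d := by
    rw [← zpow_natCast, ← zpow_add₀ (by norm_num)]
    congr 1; omega
  have hp' : (0 : ℝ) < 2 ^ p.1 := hp
  rw [hpow, mul_assoc] at h1 h2
  have h1' := le_of_mul_le_mul_left h1 hp'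
  have h2' := le_of_mul_le_mul_left h2 hp'
  refine ⟨d, fun n hn => ?_⟩
  have := mem_descendants d q.1 q.2 p.2 (by exact_mod_cast h1') (by exact_mod_cast h2') n hn
  have e : q.1 - (d : ℤ) = p.1 := by omega
  rwa [e] at this

lemma sum_descendants_le {f G W : ℤ × ℤ → ℝ} (hf : ∀ p, 0 ≤ f p) (hGW : ∀ p, G p ≤ W p)
    (hW : ∀ p, W (lhalf p) + W (rhalf p) = W p)
    (hG : ∀ p, f p + G p ≤ G (lhalf p) + G (rhalf p)) (n : ℕ) :
    ∀ q, ∑ p ∈ descendants n q, f p ≤ W q - G q := by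
  have hunion : ∀ s t : Finset (ℤ × ℤ), ∑ p ∈ s ∪ t, f p ≤ ∑ p ∈ s, f p + ∑ p ∈ t, f p := by
    intro s t
    rw [← Finset.sum_union_inter]
    exact le_add_of_nonneg_right (Finset.sum_nonneg fun p _ => hf p)
  induction n with
  | zero => intro q; simpa [descendants] using hGW q
  | succ n ih =>
    intro q
    have h1 := hunion {q} (descendants n (lhalf q) ∪ descendants n (rhalf q))
    have h2 := hunion (descendants n (lhalf q)) (descendants n (rhalf q))
    rw [Finset.sum_singleton] at h1
    rw [descendants]
    linarith [ih (lhalf q), ih (rhalf q), hW q, hG q]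

/-- If `G ≤ W`, `W` is additive and `f` is bounded by the increments of `G`, then the sum of `f`
over the dyadic subintervals of `q` is at most `W q - G q`. -/
lemma tsum_dyad_le {f G W : ℤ × ℤ → ℝ} (hf : ∀ p, 0 ≤ f p) (hGW : ∀ p, G p ≤ W p)
    (hW : ∀ p, W (lhalf p) + W (rhalf p) = W p)
    (hG : ∀ p, f p + G p ≤ G (lhalf p) + G (rhalf p)) (q : ℤ × ℤ) :
    ∑' p : {p : ℤ × ℤ // dyad p ⊆ dyad q}, ENNReal.ofReal (f p.1) ≤
      ENNReal.ofReal (W q - G q) := by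
  rw [ENNReal.tsum_eq_iSup_sum]
  refine iSup_le fun s => ?_
  rw [← ENNReal.ofReal_sum_of_nonneg fun p _ => hf p.1]
  refine ENNReal.ofReal_le_ofReal ?_
  choose N hN using fun p : {p : ℤ × ℤ // dyad p ⊆ dyad q} => exists_mem_descendants p.2
  refine le_trans ?_ (sum_descendants_le hf hGW hW hG (s.sup N + 1) q)
  have e : ∑ p ∈ s, f p.1 = ∑ p ∈ s.map (Function.Embedding.subtype _), f p := by
    rw [Finset.sum_map]; rfl
  rw [e]
  refine Finset.sum_le_sum_of_subset_of_nonneg (fun p hp => ?_) fun p _ _ => hf p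
  obtain ⟨p', hp', rfl⟩ := Finset.mem_map.1 hp
  exact hN p' _ (Nat.lt_succ_of_le (Finset.le_sup hp'))

lemma abs_mul_div_le {x y p v Q : ℝ} (hp : 0 < p) (hv : 0 < v) (hQ : p * v ≤ 2 * Q) :
    |y * x| / v ≤ x ^ 2 / p + Q * (y ^ 2 / v ^ 3) := by
  have h1 : p / (2 * v ^ 2) ≤ Q / v ^ 3 := by
    rw [div_le_div_iff₀ (by positivity) (by positivity)]
    nlinarith [pow_pos hv 2]
  have h2 := mul_le_mul_of_nonneg_right h1 (sq_nonneg y)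
  have e : Q * (y ^ 2 / v ^ 3) = Q / v ^ 3 * y ^ 2 := by ring
  have e2 : x ^ 2 / p + p / (2 * v ^ 2) * y ^ 2 - |y * x| / v =
      ((v * |x| - p * |y| / 2) ^ 2 + p ^ 2 * |y| ^ 2 / 4) / (p * v ^ 2) := by
    rw [abs_mul, ← sq_abs x, ← sq_abs y]; field_simp; ring
  have : 0 ≤ ((v * |x| - p * |y| / 2) ^ 2 + p ^ 2 * |y| ^ 2 / 4) / (p * v ^ 2) := by positivity
  linarith

/-- `∑_{I ⊆ J} |⟨ω⁻¹, h_I⟩ ⟨ω, h_{I₋}⟩| / ⟨ω⁻¹⟩_I ≤ C [ω]_{A₂} ω(J)`. -/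
theorem statement7 :
    ∃ C : ℝ≥0, ∀ ω : ℝ → ℝ, IsWeight ω → A2 ω < ⊤ → ∀ q : ℤ × ℤ,
      ∑' p : {p : ℤ × ℤ // dyad p ⊆ dyad q},
          ENNReal.ofReal
            (|haarCoeff (fun x => (ω x)⁻¹) p.1 * haarCoeff ω (lhalf p.1)| /
              avg (fun x => (ω x)⁻¹) p.1) ≤
        (C : ℝ≥0∞) * A2 ω * ENNReal.ofReal (∫ x in dyad q, ω x) := by
  refine ⟨169, fun ω hω hA q => ?_⟩
  obtain ⟨-, hpos, hi, hi'⟩ := id hω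
  set σ : ℝ → ℝ := fun x => (ω x)⁻¹ with hσ
  obtain ⟨Q, hQ⟩ : ∃ Q, Q = (A2 ω).toReal := ⟨_, rfl⟩
  have hAQ : A2 ω = ENNReal.ofReal Q := by rw [hQ, ofReal_toReal hA.ne]
  have huvQ : ∀ p, avg ω p * avg σ p ≤ Q := fun p => by
    rw [hQ]
    refine (ENNReal.ofReal_le_iff_le_toReal hA.ne).1 ?_
    exact le_iSup (fun p => ENNReal.ofReal (avg ω p * avg (fun x => (ω x)⁻¹) p)) p
  have h1uv : ∀ p, 1 ≤ avg ω p * avg σ p := one_le_avg_mul_avg_inv hω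
  have hQ0 : 0 < Q := by linarith [huvQ q, h1uv q]
  have hu : ∀ p, 0 < avg ω p := avg_pos hi hpos
  have hv : ∀ p, 0 < avg σ p := avg_pos hi' fun x => inv_pos.2 (hpos x)
  have hinv : ∀ p, 1 / avg σ p ≤ avg ω p := fun p => by
    rw [div_le_iff₀ (hv p)]; exact h1uv p
  obtain ⟨M, hM⟩ : ∃ M : ℤ × ℤ → ℝ, ∀ p, M p = len p *
      (avg ω p * Real.log (avg ω p * avg σ p) + 13 * Q / avg σ p) := ⟨_, fun _ => rfl⟩
  obtain ⟨N, hN⟩ : ∃ N : ℤ × ℤ → ℝ, ∀ p, N p = len p * (1 / avg σ p) := ⟨_, fun _ => rfl⟩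
  have hMstep : ∀ p, haarCoeff ω p ^ 2 / avg ω p ≤
      12 * (M (lhalf p) + M (rhalf p) - M p) := fun p => by
    have hb := sq_div_le_bellman (hu (lhalf p)) (hu (rhalf p)) (hv (lhalf p)) (hv (rhalf p))
      (Q := Q) (by rw [← avg_eq_halves hi, ← avg_eq_halves hi']; exact huvQ p)
    rw [← avg_eq_halves hi, ← avg_eq_halves hi'] at hb
    have := mul_le_mul_of_nonneg_left hb (mul_pos (by norm_num : (0 : ℝ) < 12) (len_pos p)).le
    have hup := (hu p).ne'
    rw [haarCoeff_sq hi, hM, hM, hM, len_lhalf, len_rhalf]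
    refine le_trans (le_of_eq ?_) (this.trans (le_of_eq ?_))
    · field_simp
    · ring
  have hM0 : ∀ p, 0 ≤ M p := fun p => by
    have h1 := Real.log_nonneg (h1uv p)
    have h2 := len_pos p
    have h3 := hu p
    have h4 := hv p
    rw [hM]
    positivity
  have hNstep : ∀ p, haarCoeff σ p ^ 2 / avg σ p ^ 3 ≤ N (lhalf p) + N (rhalf p) - N p :=
      fun p => by
    have hb := sq_div_cube_le_inv (hv (lhalf p)) (hv (rhalf p))
    rw [← avg_eq_halves hi'] at hb
    have := mul_le_mul_of_nonneg_left hb (len_pos p).le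
    rw [haarCoeff_sq hi', hN, hN, hN, len_lhalf, len_rhalf]
    refine le_trans (le_of_eq ?_) (this.trans (le_of_eq ?_))
    · ring
    · ring
  have hNle : ∀ p, N p ≤ ∫ x in dyad p, ω x := fun p => by
    rw [hN, integral_dyad_eq]
    exact mul_le_mul_of_nonneg_left (hinv p) (len_pos p).le
  have hMle : ∀ p, M p ≤ 14 * Q * ∫ x in dyad p, ω x := fun p => by
    rw [hM, integral_dyad_eq]
    have h1 : Real.log (avg ω p * avg σ p) ≤ Q := by
      linarith [Real.log_le_sub_one_of_pos (mul_pos (hu p) (hv p)), huvQ p]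
    have h2 := mul_le_mul_of_nonneg_left h1 (hu p).le
    have h3 := mul_le_mul_of_nonneg_left (hinv p) (mul_pos (by norm_num : (0 : ℝ) < 13) hQ0).le
    have h4 : 13 * Q / avg σ p = 13 * Q * (1 / avg σ p) := by ring
    have h5 := mul_le_mul_of_nonneg_left (add_le_add h2 h3) (len_pos p).le
    rw [h4]
    linarith
  have hsum := tsum_dyad_le
    (f := fun p => |haarCoeff σ p * haarCoeff ω (lhalf p)| / avg σ p)
    (G := fun p => 12 * (M (lhalf p) + M (rhalf p)) + Q * N p)
    (W := fun p => 169 * Q * ∫ x in dyad p, ω x)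
    (fun p => div_nonneg (abs_nonneg _) (hv p).le)
    (fun p => by
      have h1 := integral_dyad_split hi p
      have h2 := mul_le_mul_of_nonneg_left (hNle p) hQ0.le
      have h3 := hMle (lhalf p)
      have h4 := hMle (rhalf p)
      simp only [h1] at h2 ⊢
      linarith)
    (fun p => by
      simp only [integral_dyad_split hi p]
      ring)
    (fun p => by
      have hpv : avg ω (lhalf p) * avg σ p ≤ 2 * Q := by
        have h1 : avg ω (lhalf p) ≤ 2 * avg ω p := by
          linarith [avg_eq_halves hi p, hu (rhalf p)]
        have := mul_le_mul_of_nonneg_right h1 (hv p).le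
        linarith [huvQ p]
      have h1 := abs_mul_div_le (x := haarCoeff ω (lhalf p)) (y := haarCoeff σ p)
        (hu (lhalf p)) (hv p) hpv
      have h2 := mul_le_mul_of_nonneg_left (hNstep p) hQ0.le
      have h3 := hMstep (lhalf p)
      have h4 : 0 ≤ haarCoeff ω (rhalf p) ^ 2 / avg ω (rhalf p) :=
        div_nonneg (sq_nonneg _) (hu _).le
      have h5 := hMstep (rhalf p)
      linarith) q
  refine hsum.trans ?_
  have hG : 0 ≤ 12 * (M (lhalf q) + M (rhalf q)) + Q * N q := by
    have h1 := hM0 (lhalf q)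
    have h2 := hM0 (rhalf q)
    have h3 : 0 ≤ N q := by
      rw [hN]
      exact mul_nonneg (len_pos q).le (one_div_pos.2 (hv q)).le
    positivity
  have hC : ((169 : ℝ≥0) : ℝ≥0∞) = ENNReal.ofReal 169 := by simp
  rw [hAQ, hC, ← ENNReal.ofReal_mul (by norm_num), ← ENNReal.ofReal_mul (by positivity)]
  exact ENNReal.ofReal_le_ofReal (sub_le_self _ hG)
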